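/- arXiv:1704.00182 — 2 statements merged into one kernel-verified Lean document; each statement's English description precedes it below -/
import Mathlib

section
/- Let α ∈ (0,1) and β ∈ ℝ, let k ≥ 1, and let m_1 < m_2 < … < m_k be integers. Then the determinant of the k×k matrix whose (i,j) entry is β · α^{|m_i − m_j|} equals β^k · ∏_{l=2}^{k} (1 − α^{2(m_l − m_{l−1})}). -/
/-- The determinant of the `(k+1) × (k+1)` matrix with entries `β · α^{|m_i − m_j|}`,
for strictly increasing integers `m_0 < m_1 < … < m_k` (so the matrix size is at least `1`),
equals `β^{k+1} · ∏_{l=1}^{k} (1 − α^{2(m_l − m_{l−1})})`. -/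
theorem det_renewal_matrix (α β : ℝ) (hα : α ∈ Set.Ioo (0 : ℝ) 1)
    (k : ℕ) (m : Fin (k + 1) → ℤ) (hm : StrictMono m) :
    Matrix.det (Matrix.of fun i j : Fin (k + 1) => β * α ^ |m i - m j|) =
      β ^ (k + 1) * ∏ l : Fin k, (1 - α ^ (2 * (m l.succ - m l.castSucc))) := by
  have hα0 : α ≠ 0 := hα.1.ne'
  set A : Matrix (Fin (k + 1)) (Fin (k + 1)) ℝ :=
    Matrix.of fun i j => β * α ^ |m i - m j|
  let c : Fin k → ℝ := fun i => α ^ (m i.succ - m i.castSucc)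
  -- Subtracting `c i` times each row from the next one makes the matrix upper triangular.
  let B : Matrix (Fin (k + 1)) (Fin (k + 1)) ℝ :=
    Matrix.of (Fin.cons (A 0) fun i j => A i.succ j - c i * A i.castSucc j)
  have hB : B.BlockTriangular id := by
    intro i j hij
    cases i using Fin.cases with
    | zero => exact absurd hij (Fin.not_lt_zero j)
    | succ i =>
      have hj : m j ≤ m i.castSucc := hm.monotone (Fin.le_castSucc_iff.mpr hij)
      have hi : m i.castSucc < m i.succ := hm i.castSucc_lt_succ
      simp only [B, A, c, Matrix.of_apply, Fin.cons_succ]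
      rw [abs_of_nonneg (by lia), abs_of_nonneg (by lia), mul_left_comm, ← zpow_add₀ hα0,
        sub_add_sub_cancel, sub_self]
  have hdiag (i : Fin k) :
      B i.succ i.succ = β * (1 - α ^ (2 * (m i.succ - m i.castSucc))) := by
    have hi : m i.castSucc < m i.succ := hm i.castSucc_lt_succ
    simp only [B, A, c, Matrix.of_apply, Fin.cons_succ]
    rw [sub_self, abs_zero, zpow_zero, abs_sub_comm, abs_of_pos (by lia), mul_left_comm,
      ← zpow_add₀ hα0, ← two_mul, mul_one, mul_one_sub]
  have hdet : A.det = B.det :=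
    Matrix.det_eq_of_forall_row_eq_smul_add_pred c (fun j => by simp [B])
      (fun i j => by simp [B])
  rw [hdet, Matrix.det_of_isUpperTriangular hB, Fin.prod_univ_succ]
  simp only [hdiag, Finset.prod_mul_distrib, Finset.prod_const, Finset.card_univ, Fintype.card_fin]
  simp [B, A, pow_succ']
  ring
end

section
/- Let M be the 5×5 integer matrix with rows (2,1,0,0,0), (1,0,1,1,1), (1,1,0,0,0), (0,0,2,0,1), (0,0,1,0,1). Then the characteristic polynomial of M is x⁵ − 3x⁴ + 3x − 1, and over the complex numbers this polynomial factors as (x − 1)·(x − (γ + √γ))·(x − (γ − √γ))·(x − (−γ^{−1} + i/√γ))·(x − (−γ^{−1} − i/√γ)), where γ = (1+√5)/2 is the golden ratio and i = √(−1). -/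
noncomputable section

open Polynomial

/-- The golden ratio `γ = (1 + √5)/2`. -/
def gold : ℝ := (1 + Real.sqrt 5) / 2

/-- The 5×5 integer matrix `M` from the transfer-matrix analysis of the helix-3 graph. -/
def M5 : Matrix (Fin 5) (Fin 5) ℤ :=
  !![2, 1, 0, 0, 0;
     1, 0, 1, 1, 1;
     1, 1, 0, 0, 0;
     0, 0, 2, 0, 1;
     0, 0, 1, 0, 1]

theorem gold_sq : gold ^ 2 = gold + 1 := by
  have h : Real.sqrt 5 ^ 2 = 5 := Real.sq_sqrt (by norm_num)
  unfold gold
  linear_combination h / 4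

theorem gold_pos : 0 < gold := by
  unfold gold
  positivity

theorem gold_inv : gold⁻¹ = gold - 1 :=
  inv_eq_of_mul_eq_one_right (by linear_combination gold_sq)

theorem inv_sqrt_gold : (Real.sqrt gold)⁻¹ = Real.sqrt gold * (gold - 1) :=
  inv_eq_of_mul_eq_one_right (by
    linear_combination (gold - 1) * Real.sq_sqrt gold_pos.le + gold_sq)

theorem charpoly_M5 :
    M5.charpoly = X ^ 5 - 3 * X ^ 4 + 3 * X - 1 ∧
    (X ^ 5 - 3 * X ^ 4 + 3 * X - 1 : ℂ[X]) =
      (X - C 1) *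
      (X - C (((gold + Real.sqrt gold : ℝ)) : ℂ)) *
      (X - C (((gold - Real.sqrt gold : ℝ)) : ℂ)) *
      (X - C (-((gold⁻¹ : ℝ) : ℂ) + Complex.I / ((Real.sqrt gold : ℝ) : ℂ))) *
      (X - C (-((gold⁻¹ : ℝ) : ℂ) - Complex.I / ((Real.sqrt gold : ℝ) : ℂ))) := by
  constructor
  · rw [Matrix.charpoly, Matrix.charmatrix, M5]
    simp [Matrix.det_succ_row_zero, Fin.sum_univ_succ, Fin.succAbove, Matrix.submatrix]
    ring
  · have hg : (gold : ℂ) ^ 2 = gold + 1 := by exact_mod_cast gold_sq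
    have hs : (Real.sqrt gold : ℂ) ^ 2 = gold := by
      exact_mod_cast Real.sq_sqrt gold_pos.le
    rw [div_eq_mul_inv, ← Complex.ofReal_inv, inv_sqrt_gold, gold_inv]
    push_cast
    generalize (gold : ℂ) = g at *
    generalize (Real.sqrt gold : ℂ) = s at *
    have h₁ : (X - C (g + s)) * (X - C (g - s)) = X ^ 2 - 2 * C g * X + 1 := by
      have h : C g ^ 2 - C s ^ 2 = (1 : ℂ[X]) := by
        rw [← C_pow, ← C_pow, hs, hg]
        simp
      simp only [C_add, C_sub]
      linear_combination h
    have h₂ : (X - C (-(g - 1) + Complex.I * (s * (g - 1)))) *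
        (X - C (-(g - 1) - Complex.I * (s * (g - 1)))) =
          X ^ 2 + 2 * (C g - 1) * X + 1 := by
      have h : (g - 1) ^ 2 - Complex.I ^ 2 * (s * (g - 1)) ^ 2 = 1 := by
        rw [Complex.I_sq]
        linear_combination (g - 1) ^ 2 * hs + g * hg
      have hC := congrArg (C : ℂ → ℂ[X]) h
      simp only [C_add, C_sub, C_neg, C_mul, C_pow, C_1] at hC ⊢
      linear_combination hC
    have hC : C g ^ 2 = C g + (1 : ℂ[X]) := by
      rw [← C_pow, hg]
      simp
    rw [mul_assoc (X - C 1), h₁, mul_assoc, h₂, C_1]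
    linear_combination 4 * X ^ 2 * (X - 1) * hC
end
end
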